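/- Let w be a k×ℓ partial permutation and let P be a pipe dream with Demazure product δ(P) = w̃, i.e., P ∈ 𝒫(w). Then every crossing tile of P lies in the union of all reduced pipe dreams for w: for every position (i,j) ∈ P there exists a reduced pipe dream D ∈ RP(w) with (i,j) ∈ D. -/

import Mathlib

open scoped Classical

noncomputable section

/-! ### Pipe dreams and Demazure products -/

/-- A pipe dream: the set of crossing tiles (0-based positions). -/
abbrev PD := Finset (ℕ × ℕ)

/-- The simple reflection `s_i` (0-based: swaps `i` and `i+1`). -/
def sGen (i : ℕ) : Equiv.Perm ℕ := Equiv.swap i (i + 1)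

/-- Coxeter length of a permutation of `ℕ`: the number of inversions. -/
noncomputable def clen (v : Equiv.Perm ℕ) : ℕ :=
  Set.ncard {pq : ℕ × ℕ | pq.1 < pq.2 ∧ v pq.2 < v pq.1}

/-- One step of the Demazure (0-Hecke) product: multiply by `s_i` unless it drops length. -/
noncomputable def demStep (w : Equiv.Perm ℕ) (i : ℕ) : Equiv.Perm ℕ :=
  if clen w < clen (w * sGen i) then w * sGen i else w

/-- Demazure product of a word in the simple reflections. -/
noncomputable def demWord (word : List ℕ) : Equiv.Perm ℕ := word.foldl demStep 1

/-- A pipe dream fits in the `k × l` grid. -/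
def InGrid (k l : ℕ) (P : PD) : Prop := ∀ pq ∈ P, pq.1 < k ∧ pq.2 < l

/-- The crossing tiles of `P` in reading order: along rows, right to left,
top to bottom. -/
def posList (k l : ℕ) (P : PD) : List (ℕ × ℕ) :=
  (List.range k).flatMap fun i =>
    ((List.range l).reverse).filterMap fun j => if (i, j) ∈ P then some (i, j) else none

/-- The word of a pipe dream: the crossing tile at (0-based) `(i,j)` contributes the
letter `i + j` (antidiagonal index), read along rows right-to-left, top-to-bottom. -/
def pdWord (k l : ℕ) (P : PD) : List ℕ := (posList k l P).map fun pq => pq.1 + pq.2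

/-- The Demazure product `δ(P)` of a pipe dream. -/
noncomputable def pdDelta (k l : ℕ) (P : PD) : Equiv.Perm ℕ := demWord (pdWord k l P)

/-- `P` rotated through 180 degrees inside the `k × l` grid. -/
def rot180 (k l : ℕ) (P : PD) : PD := P.image fun pq => (k - 1 - pq.1, l - 1 - pq.2)

/-- The simplification of `P`: omit the `t`-th letter whenever the Demazure product of
the length-`t` prefix equals that of the length-`t+1` prefix (lexicographically first
subword with full Demazure product). -/
noncomputable def simplification (k l : ℕ) (P : PD) : PD :=
  P.filter fun pos => ∀ t : ℕ, (posList k l P)[t]? = some pos →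
    demWord ((pdWord k l P).take (t + 1)) ≠ demWord ((pdWord k l P).take t)

/-! ### Partial permutations -/

/-- A `k × l` partial permutation, as the relation `rel p q` ⟺ "entry 1 at `(p,q)`"
(0-based): at most one nonzero entry in each row and column. -/
def IsPartialPerm (k l : ℕ) (rel : ℕ → ℕ → Prop) : Prop :=
  (∀ p q, rel p q → p < k ∧ q < l) ∧
  (∀ p q q', rel p q → rel p q' → q = q') ∧
  (∀ p p' q, rel p q → rel p' q → p = p')

/-- `v ∈ S_∞` is a completion of the `k × l` partial permutation `rel`:
a (finitely supported) permutation whose upper-left `k × l` corner is `rel`. -/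
def IsCompletion (k l : ℕ) (rel : ℕ → ℕ → Prop) (v : Equiv.Perm ℕ) : Prop :=
  (∃ N, ∀ i, N ≤ i → v i = i) ∧ ∀ p q, p < k → q < l → (rel p q ↔ v p = q)

/-- `v = w̃` is the minimal-length completion of `rel`. -/
def IsMinCompletion (k l : ℕ) (rel : ℕ → ℕ → Prop) (v : Equiv.Perm ℕ) : Prop :=
  IsCompletion k l rel v ∧ ∀ v', IsCompletion k l rel v' → clen v ≤ clen v'

/-- The minimal-length completion `w̃` of a partial permutation. -/
noncomputable def minComp (k l : ℕ) (rel : ℕ → ℕ → Prop) : Equiv.Perm ℕ :=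
  Classical.epsilon (IsMinCompletion k l rel)

/-- `P ∈ 𝒫(w)`: pipe dreams in the `k × l` grid with Demazure product `w̃`. -/
def PipeDreamsFor (k l : ℕ) (rel : ℕ → ℕ → Prop) (P : PD) : Prop :=
  InGrid k l P ∧ pdDelta k l P = minComp k l rel


/-! ### Block decompositions and Zelevinsky permutations -/

/-- `rowSum r j = r 0 + ⋯ + r (j-1)`. -/
def rowSum (r : ℕ → ℕ) (j : ℕ) : ℕ := ∑ q ∈ Finset.range j, r q

/-- Total size `d = r 0 + ⋯ + r n`. -/
def dTot (n : ℕ) (r : ℕ → ℕ) : ℕ := rowSum r (n + 1)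

/-- Global row `p` lies in block row `j` (block rows counted from the top, of heights
`r 0, …, r n`). -/
def InBlockRow (r : ℕ → ℕ) (j p : ℕ) : Prop := rowSum r j ≤ p ∧ p < rowSum r (j + 1)

/-- Global column `q` lies in block column `i` *from the right* (widths `r 0, …, r n`
from the right). -/
def InBlockCol (n : ℕ) (r : ℕ → ℕ) (i q : ℕ) : Prop :=
  dTot n r - rowSum r (i + 1) ≤ q ∧ q < dTot n r - rowSum r i

/-- `v` is a Zelevinsky permutation for the block decomposition given by
`r 0, …, r n`: it is a `d × d` permutation matrix (fixes everything from `d` on),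
the blocks `B_{ji}` with `i ≥ j + 2` vanish, and the nonzero entries proceed from
northwest to southeast within each block row and block column. -/
def IsZelevinsky (n : ℕ) (r : ℕ → ℕ) (v : Equiv.Perm ℕ) : Prop :=
  (∀ p, dTot n r ≤ p → v p = p) ∧
  (∀ p, p < dTot n r → ∀ j i, j ≤ n → i ≤ n → InBlockRow r j p →
    InBlockCol n r i (v p) → i ≤ j + 1) ∧
  (∀ p p', p < p' → p' < dTot n r →
    ((∃ j ≤ n, InBlockRow r j p ∧ InBlockRow r j p') ∨
     (∃ i ≤ n, InBlockCol n r i (v p) ∧ InBlockCol n r i (v p'))) → v p < v p')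

/-- The rank array of a Zelevinsky permutation: `r_{ij}` is the number of nonzero
entries of `v` in the blocks weakly southeast of `B_{ji}`. -/
def rankArray (n : ℕ) (r : ℕ → ℕ) (v : Equiv.Perm ℕ) (i j : ℕ) : ℕ :=
  ((Finset.range (dTot n r)).filter fun p =>
    rowSum r j ≤ p ∧ dTot n r - rowSum r (i + 1) ≤ v p).card

/-- `v = v(Hom)`: the unique Zelevinsky permutation with entrywise maximal rank array. -/
def IsHomZel (n : ℕ) (r : ℕ → ℕ) (v : Equiv.Perm ℕ) : Prop :=
  IsZelevinsky n r v ∧ ∀ v', IsZelevinsky n r v' →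
    ∀ i j, j ≤ i → i ≤ n → rankArray n r v' i j ≤ rankArray n r v i j

/-- `vm = v(m + r)` where `v = v(r)`: the Zelevinsky permutation for the ranks
`m + r 0, …, m + r n` whose rank array is obtained by adding `m` to every entry of
the rank array of `v`. -/
def IsShiftedZel (n : ℕ) (r : ℕ → ℕ) (v : Equiv.Perm ℕ) (m : ℕ) (vm : Equiv.Perm ℕ) : Prop :=
  IsZelevinsky n (fun j => m + r j) vm ∧
  ∀ i j, j ≤ i → i ≤ n →
    rankArray n (fun j => m + r j) vm i j = m + rankArray n r v i j

/-- The Ferrers shape `D_Hom` of all positions strictly above the block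
superantidiagonal (blocks `B_{ji}` with `i ≥ j + 2`). -/
def DHom (n : ℕ) (r : ℕ → ℕ) : PD :=
  (Finset.range (dTot n r) ×ˢ Finset.range (dTot n r)).filter fun pq =>
    ∃ j ≤ n, ∃ i ≤ n, InBlockRow r j pq.1 ∧ InBlockCol n r i pq.2 ∧ j + 2 ≤ i

/-- `P(P_1, …, P_n)`: the `d × d` pipe dream with every block strictly above the block
superantidiagonal filled with crossing tiles, the superantidiagonal `r (j-1) × r j`
block in block row `j - 1` equal to `P j`, and all other blocks empty. -/
def assemble (n : ℕ) (r : ℕ → ℕ) (P : ℕ → PD) : PD :=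
  (Finset.range (dTot n r) ×ˢ Finset.range (dTot n r)).filter fun pq =>
    (∃ j ≤ n, ∃ i ≤ n, InBlockRow r j pq.1 ∧ InBlockCol n r i pq.2 ∧ j + 2 ≤ i) ∨
    (∃ j, 1 ≤ j ∧ j ≤ n ∧ InBlockRow r (j - 1) pq.1 ∧ InBlockCol n r j pq.2 ∧
      (pq.1 - rowSum r (j - 1), pq.2 - (dTot n r - rowSum r (j + 1))) ∈ P j)

/-! ### Lacing diagrams -/

/-- A lacing diagram for ranks `r 0, …, r n`: a list `w_1, …, w_n` of partial
permutations, `w_j` of size `r (j-1) × r j` (encoded as relations, with `L j` empty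
for `j` out of range). -/
def IsLacingDiagram (n : ℕ) (r : ℕ → ℕ) (L : ℕ → ℕ → ℕ → Prop) : Prop :=
  (∀ j, 1 ≤ j → j ≤ n → IsPartialPerm (r (j - 1)) (r j) (L j)) ∧
  (∀ j, j = 0 ∨ n < j → L j = fun _ _ => False)

/-- A choice of pipe dreams `P_1, …, P_n` with `P̌_j ∈ 𝒫(w_j)` for all `j`. -/
def LacingChoices (n : ℕ) (r : ℕ → ℕ) (L : ℕ → ℕ → ℕ → Prop) (P : ℕ → PD) : Prop :=
  ∀ j, 1 ≤ j → j ≤ n → InGrid (r (j - 1)) (r j) (P j) ∧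
    PipeDreamsFor (r (j - 1)) (r j) (L j) (rot180 (r (j - 1)) (r j) (P j))

/-- The Demazure product of the lacing diagram `L` is the rank array of the Zelevinsky
permutation `v`: for some (equivalently every) choice of pipe dreams `P_j` with
`P̌_j ∈ 𝒫(w_j)`, the Demazure product of `P(P_1, …, P_n)` is `v`. -/
def LacingDem (n : ℕ) (r : ℕ → ℕ) (L : ℕ → ℕ → ℕ → Prop) (v : Equiv.Perm ℕ) : Prop :=
  (∃ P, LacingChoices n r L P) ∧
  ∀ P, LacingChoices n r L P →
    pdDelta (dTot n r) (dTot n r) (assemble n r P) = v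

/-- `L(r)`: lacing diagrams whose Demazure product is the rank array of `v = v(r)`. -/
def LacingSet (n : ℕ) (r : ℕ → ℕ) (v : Equiv.Perm ℕ) : Set (ℕ → ℕ → ℕ → Prop) :=
  {L | IsLacingDiagram n r L ∧ LacingDem n r L v}

/-- `m + w`: let the partial permutation act on `{m, m+1, …}` instead of `{0, 1, …}`. -/
def shiftRel (m : ℕ) (rel : ℕ → ℕ → Prop) : ℕ → ℕ → Prop :=
  fun p q => m ≤ p ∧ m ≤ q ∧ rel (p - m) (q - m)

/-- `m + w` for a lacing diagram, componentwise. -/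
def shiftDiag (m : ℕ) (L : ℕ → ℕ → ℕ → Prop) : ℕ → ℕ → ℕ → Prop :=
  fun j => shiftRel m (L j)

/-- `l(w) = Σ_j l(w̃_j)` for a lacing diagram. -/
noncomputable def lenLacing (n : ℕ) (r : ℕ → ℕ) (L : ℕ → ℕ → ℕ → Prop) : ℕ :=
  ∑ j ∈ Finset.Icc 1 n, clen (minComp (r (j - 1)) (r j) (L j))


/-! ### Double Grothendieck polynomials

We encode a Laurent polynomial in the row alphabet `z` and column alphabet `ż` as an
honest polynomial in the variables `z i = X (Sum.inl i)` and `b j = X (Sum.inr j)`,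
where `b j` stands for the reciprocal `1/ż j` (all the `G`'s are polynomials in the
`z i` and the `ż j⁻¹`; in particular `1 - z i / ż j = 1 - z i * b j`). -/

/-- The ambient polynomial ring. -/
abbrev GR : Type := MvPolynomial (ℕ ⊕ ℕ) ℚ

/-- The row variable `z i` (0-based). -/
noncomputable def Zv (i : ℕ) : GR := MvPolynomial.X (Sum.inl i)

/-- The column variable `b j = 1 / ż j` (0-based). -/
noncomputable def Bv (j : ℕ) : GR := MvPolynomial.X (Sum.inr j)

/-- Exact division in a ring (junk value `0` if `b ∤ a`). -/
noncomputable def exactDiv (a b : GR) : GR := if h : ∃ c, a = b * c then h.choose else 0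

/-- The `i`-th Demazure operator
`∂_i f = (z_{i+1} f(z_i, z_{i+1}) - z_i f(z_{i+1}, z_i)) / (z_{i+1} - z_i)`
(0-based `i`; it acts on the `z` alphabet only). -/
noncomputable def demOp (i : ℕ) (f : GR) : GR :=
  exactDiv
    (Zv (i + 1) * f -
      Zv i * (MvPolynomial.rename (fun s => Equiv.swap (Sum.inl i) (Sum.inl (i + 1)) s) f))
    (Zv (i + 1) - Zv i)

/-- The longest element `w_0` of `S_k` (0-based; fixes everything from `k` on). -/
def w0 (k : ℕ) : Equiv.Perm ℕ :=
  Function.Involutive.toPerm (fun i => if i < k then k - 1 - i else i)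
    (by intro i; dsimp only; split_ifs <;> omega)

/-- The top double Grothendieck polynomial
`G_{w_0}(z/ż) = ∏_{i + j ≤ k} (1 - z_i/ż_j)` (1-based indices `i, j ≥ 1`). -/
noncomputable def GrothTop (k : ℕ) : GR :=
  ∏ pq ∈ (Finset.range k ×ˢ Finset.range k).filter (fun pq => pq.1 + pq.2 + 2 ≤ k),
    (1 - Zv pq.1 * Bv pq.2)

/-- Auxiliary fuelled recursion computing double Grothendieck polynomials via
`G_{v s_i} = ∂_i G_v` whenever `l(v s_i) < l(v)`. -/
noncomputable def GrothAux (k : ℕ) : ℕ → Equiv.Perm ℕ → GR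
  | 0, v => if v = w0 k then GrothTop k else 0
  | fuel + 1, v =>
    if v = w0 k then GrothTop k
    else if h : ∃ i, i + 2 ≤ k ∧ v i < v (i + 1) then
      demOp (Nat.find h) (GrothAux k fuel (v * sGen (Nat.find h)))
    else 0

/-- The double Grothendieck polynomial `G_v(z/ż)` of `v ∈ S_k`. -/
noncomputable def Groth (k : ℕ) (v : Equiv.Perm ℕ) : GR := GrothAux k (k * k) v

/-- The least `N` such that `v` fixes everything from `N` on. -/
noncomputable def permBound (v : Equiv.Perm ℕ) : ℕ := sInf {N | ∀ i, N ≤ i → v i = i}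

/-- The double Grothendieck polynomial of a finitely supported permutation
(independent of the choice of `k`). -/
noncomputable def GrothPerm (v : Equiv.Perm ℕ) : GR := Groth (permBound v) v


/-! ### Quiver alphabets

For ranks `r 0, …, r n` with `d = r 0 + ⋯ + r n`, the row alphabet
`x = x^0, …, x^n` is the concatenation of alphabets of sizes `r 0, …, r n`: the global
row variable `z p` (for `p` in block row `j` at offset `a`) *is* the letter `x^j_{a+1}`.
Likewise the column alphabet `ȳ = y^n, …, y^0` is the concatenation of alphabets of
sizes `r n, …, r 0`: the global column variable `ż q` for `q` in block column `i`
(from the right) at offset `a` (from the left of the block) is the letter `y^i_{a+1}`.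
Thus `G_{v(r)}(x/ȳ)` is just `Groth d (v(r))`. -/

/-- The block row containing global row `p`. -/
noncomputable def blockRowOf (r : ℕ → ℕ) (p : ℕ) : ℕ :=
  if h : ∃ j, p < rowSum r (j + 1) then Nat.find h else 0

/-- The block column (from the right) containing global column `q`. -/
noncomputable def blockColOf (n : ℕ) (r : ℕ → ℕ) (q : ℕ) : ℕ :=
  if h : ∃ i, dTot n r ≤ q + rowSum r (i + 1) then Nat.find h else 0

/-- The row variable at global row `p` after reversing each alphabet `x^j` in place. -/
noncomputable def revRow (r : ℕ → ℕ) (p : ℕ) : ℕ :=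
  rowSum r (blockRowOf r p) + (r (blockRowOf r p) - 1 - (p - rowSum r (blockRowOf r p)))

/-- The column variable at global column `q` after reversing each alphabet `y^i` in
place. -/
noncomputable def revCol (n : ℕ) (r : ℕ → ℕ) (q : ℕ) : ℕ :=
  (dTot n r - rowSum r (blockColOf n r q + 1)) +
    (r (blockColOf n r q) - 1 - (q - (dTot n r - rowSum r (blockColOf n r q + 1))))

/-- The exponential reverse monomial `(1 - x̃/ỹ)^P = ∏_{+ ∈ P} (1 - x̃_+/ỹ_+)`. -/
noncomputable def ERM (n : ℕ) (r : ℕ → ℕ) (P : PD) : GR :=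
  ∏ pq ∈ P, (1 - Zv (revRow r pq.1) * Bv (revCol n r pq.2))

/-- Set the last `ℓ` variables of every finite alphabet `x^j` and `y^i` equal to `1`. -/
noncomputable def setLastOnes (n : ℕ) (r : ℕ → ℕ) (ℓ : ℕ) : GR →ₐ[ℚ] GR :=
  MvPolynomial.aeval fun s =>
    match s with
    | Sum.inl p =>
      if ∃ j ≤ n, InBlockRow r j p ∧ rowSum r (j + 1) ≤ p + ℓ then 1 else Zv p
    | Sum.inr q =>
      if ∃ i ≤ n, InBlockCol n r i q ∧ dTot n r - rowSum r i ≤ q + ℓ then 1 else Bv q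

/-- For rank lists `big` and `small` (with `small j ≤ big j`): keep the first `small j`
letters of each alphabet of sizes `big 0, …, big n` (relabelling them as the alphabets
of sizes `small 0, …, small n`) and set all remaining letters equal to `1`. -/
noncomputable def restrictAlph (n : ℕ) (big small : ℕ → ℕ) : GR →ₐ[ℚ] GR :=
  MvPolynomial.aeval fun s =>
    match s with
    | Sum.inl p =>
      if p < dTot n big then
        if p - rowSum big (blockRowOf big p) < small (blockRowOf big p) then
          Zv (rowSum small (blockRowOf big p) + (p - rowSum big (blockRowOf big p)))
        else 1
      else Zv p
    | Sum.inr q =>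
      if q < dTot n big then
        if q - (dTot n big - rowSum big (blockColOf n big q + 1)) < small (blockColOf n big q)
        then
          Bv ((dTot n small - rowSum small (blockColOf n big q + 1)) +
            (q - (dTot n big - rowSum big (blockColOf n big q + 1))))
        else 1
      else Bv q

/-- Keep the first `k` letters of the (generic) row alphabet and the first `l` letters
of the column alphabet, setting all further letters equal to `1`. -/
noncomputable def truncAlph (k l : ℕ) : GR →ₐ[ℚ] GR :=
  MvPolynomial.aeval fun s =>
    match s with
    | Sum.inl p => if p < k then Zv p else 1
    | Sum.inr q => if q < l then Bv q else 1

/-- Substitute the generic alphabets `z, ż` by the alphabets `x^{j-1}, y^j`: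
`G(z/ż) ↦ G(x^{j-1}/y^j)`. -/
noncomputable def placeBlock (n : ℕ) (r : ℕ → ℕ) (j : ℕ) : GR →ₐ[ℚ] GR :=
  MvPolynomial.rename
    (Sum.map (fun a => rowSum r (j - 1) + a) (fun a => (dTot n r - rowSum r (j + 1)) + a))

/-- `m + v`: let the permutation act on `{m, m+1, …}` instead of `{0, 1, …}`. -/
noncomputable def shiftPerm (m : ℕ) (v : Equiv.Perm ℕ) : Equiv.Perm ℕ :=
  v.viaEmbedding ⟨fun a => m + a, add_right_injective m⟩

/-! ### Stable double Grothendieck polynomials -/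

/-- The stable double Grothendieck polynomial of a `k × l` partial permutation,
evaluated in alphabets of sizes `k'` and `l'`:
`lim_{m → ∞} G_{m+w}(z_{k'}/ż_{l'})`, the (eventually constant) limit of the double
Grothendieck polynomials of `m + w` with all variables beyond the first `k'` (resp.
`l'`) set equal to `1`. -/
noncomputable def stableTruncPP (k l k' l' : ℕ) (rel : ℕ → ℕ → Prop) : GR :=
  Classical.epsilon fun g => ∃ M, ∀ m, M ≤ m →
    truncAlph k' l' (GrothPerm (minComp (m + k) (m + l) (shiftRel m rel))) = g

/-- `Ĝ_w(z_k/ż_l)` for a `k × l` partial permutation `w`. -/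
noncomputable def stableGrothPP (k l : ℕ) (rel : ℕ → ℕ → Prop) : GR :=
  stableTruncPP k l k l rel

/-- `Ĝ_μ(z_{k'}/ż_{l'})` for a (finitely supported) permutation `μ`. -/
noncomputable def stableTruncPerm (k' l' : ℕ) (μ : Equiv.Perm ℕ) : GR :=
  Classical.epsilon fun g => ∃ M, ∀ m, M ≤ m →
    truncAlph k' l' (GrothPerm (shiftPerm m μ)) = g

/-- `Ĝ_w(x/ȳ) = Ĝ_{w_1}(x^0/y^1) ⋯ Ĝ_{w_n}(x^{n-1}/y^n)` for a lacing diagram. -/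
noncomputable def GhatLacing (n : ℕ) (r : ℕ → ℕ) (L : ℕ → ℕ → ℕ → Prop) : GR :=
  ∏ j ∈ Finset.Icc 1 n, placeBlock n r j (stableGrothPP (r (j - 1)) (r j) (L j))

/-- A (finitely supported) permutation is grassmannian if it has at most one descent. -/
def IsGrassmannian (μ : Equiv.Perm ℕ) : Prop :=
  (∃ N, ∀ i, N ≤ i → μ i = i) ∧ ∀ i i', μ (i + 1) < μ i → μ (i' + 1) < μ i' → i = i'

/-- Grassmannian lacing diagrams: those whose minimal completions are all grassmannian. -/
def GrassLacingSet (n : ℕ) (r : ℕ → ℕ) : Set (ℕ → ℕ → ℕ → Prop) :=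
  {M | IsLacingDiagram n r M ∧
    ∀ j, 1 ≤ j → j ≤ n → IsGrassmannian (minComp (r (j - 1)) (r j) (M j))}

/-! ### Pipes, top pipe dreams and absorbable elbows -/

/-- One step of a pipe through the tiling determined by `P` in a grid with `l` columns.
A state is `(i, j, fromW)`: the pipe is at tile `(i, j)`, having entered from the west
(`fromW = true`) or from the south (`fromW = false`).  At a crossing the pipe goes
straight; at an elbow it turns (west ↝ north, south ↝ east).  Pipes move only north
and east; `none` means the pipe exits the grid. -/
def nextState (l : ℕ) (P : PD) : ℕ × ℕ × Bool → Option (ℕ × ℕ × Bool) := fun s =>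
  let i := s.1
  let j := s.2.1
  let fromW := s.2.2
  if ((i, j) ∈ P ∧ fromW = true) ∨ ((i, j) ∉ P ∧ fromW = false) then
    -- exit east
    if j + 1 < l then some (i, j + 1, true) else none
  else
    -- exit north
    if 0 < i then some (i - 1, j, false) else none

/-- The (fuelled) forward trajectory of a pipe from a given state. -/
noncomputable def traj (l : ℕ) (P : PD) : ℕ → ℕ × ℕ × Bool → List (ℕ × ℕ × Bool)
  | 0, s => [s]
  | fuel + 1, s =>
    s :: (match nextState l P s with
      | none => []
      | some s' => traj l P fuel s')

/-- The pipe of `P` moving forward from state `s` passes through the tile `c`. -/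
def passesThrough (k l : ℕ) (P : PD) (s : ℕ × ℕ × Bool) (c : ℕ × ℕ) : Prop :=
  ∃ st ∈ traj l P (k + l + 2) s, (st.1, st.2.1) = c

/-- An elbow tile `e` of the pipe dream `D` (in the `k × l` grid) is absorbable if the
two pipes passing through it cross in a crossing tile (necessarily to its northeast). -/
def Absorbable (k l : ℕ) (D : PD) (e : ℕ × ℕ) : Prop :=
  e.1 < k ∧ e.2 < l ∧ e ∉ D ∧
  ∃ c ∈ D, passesThrough k l D (e.1, e.2, true) c ∧ passesThrough k l D (e.1, e.2, false) c

/-- `D` is the top pipe dream of the `k × l` partial permutation `rel`: the unique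
reduced pipe dream for `rel` having no elbow tile due north of a crossing tile. -/
def IsTopPipeDream (k l : ℕ) (rel : ℕ → ℕ → Prop) (D : PD) : Prop :=
  PipeDreamsFor k l rel D ∧ D.card = clen (minComp k l rel) ∧
  ∀ i i' j, i < i' → (i', j) ∈ D → (i, j) ∈ D

/-- `α|P`: add `α` columns of crossing tiles on the left side of the `k × l`
pipe dream `P`. -/
def addCols (k α : ℕ) (P : PD) : PD :=
  (Finset.range k ×ˢ Finset.range α) ∪ P.image fun pq => (pq.1, pq.2 + α)


/-! ### Inversions and multiplication by a simple reflection -/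

/-- The inversion set of a permutation of `ℕ`. -/
def invSet (v : Equiv.Perm ℕ) : Set (ℕ × ℕ) := {pq | pq.1 < pq.2 ∧ v pq.2 < v pq.1}

theorem sGen_mul_self (i : ℕ) : sGen i * sGen i = 1 := Equiv.swap_mul_self _ _

theorem mul_sGen_mul_sGen (v : Equiv.Perm ℕ) (i : ℕ) : v * sGen i * sGen i = v := by
  rw [mul_assoc, sGen_mul_self, mul_one]

theorem sGen_apply (i x : ℕ) :
    sGen i x = if x = i then i + 1 else if x = i + 1 then i else x :=
  Equiv.swap_apply_def _ _ _

theorem invSet_mul_sGen {v : Equiv.Perm ℕ} {i : ℕ} (h : v i < v (i + 1)) :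
    invSet (v * sGen i) =
      insert (i, i + 1) ((Equiv.prodCongr (sGen i) (sGen i)) '' invSet v) := by
  have hs : ∀ x, sGen i (sGen i x) = x := fun x => by
    rw [← Equiv.Perm.mul_apply, sGen_mul_self, Equiv.Perm.one_apply]
  ext ⟨p, q⟩
  simp only [invSet, Set.mem_ofPred_eq, Set.mem_insert_iff, Set.mem_image, Prod.exists,
    Equiv.prodCongr_apply, Prod.map_apply, Prod.mk.injEq, Equiv.Perm.mul_apply]
  constructor
  · rintro ⟨hpq, hv⟩
    by_cases hc : p = i ∧ q = i + 1
    · exact Or.inl hc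
    · refine Or.inr ⟨sGen i p, sGen i q, ⟨?_, hv⟩, hs p, hs q⟩
      simp only [sGen_apply]
      split_ifs <;> omega
  · rintro (⟨rfl, rfl⟩ | ⟨a, b, ⟨hab, hv⟩, rfl, rfl⟩)
    · simpa [sGen] using h
    · rw [hs, hs]
      refine ⟨?_, hv⟩
      have hc : ¬ (a = i ∧ b = i + 1) := by
        rintro ⟨rfl, rfl⟩
        exact absurd hv (not_lt.mpr h.le)
      simp only [sGen_apply]
      split_ifs <;> omega

theorem finite_invSet_mul_sGen_of_lt {v : Equiv.Perm ℕ} {i : ℕ} (hv : (invSet v).Finite)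
    (h : v i < v (i + 1)) : (invSet (v * sGen i)).Finite := by
  rw [invSet_mul_sGen h]
  exact (hv.image _).insert _

theorem clen_mul_sGen_of_lt {v : Equiv.Perm ℕ} {i : ℕ} (hv : (invSet v).Finite)
    (h : v i < v (i + 1)) : clen (v * sGen i) = clen v + 1 := by
  change (invSet (v * sGen i)).ncard = (invSet v).ncard + 1
  rw [invSet_mul_sGen h, Set.ncard_insert_of_notMem _ (hv.image _),
    Set.ncard_image_of_injective _ (Equiv.injective _)]
  rintro ⟨⟨a, b⟩, ⟨hab, -⟩, he⟩
  simp only [Equiv.prodCongr_apply, Prod.map_apply, Prod.mk.injEq, sGen_apply] at he hab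
  split_ifs at he <;> omega

theorem mul_sGen_lt_of_gt {v : Equiv.Perm ℕ} {i : ℕ} (h : v (i + 1) < v i) :
    (v * sGen i) i < (v * sGen i) (i + 1) := by
  simpa [sGen] using h

theorem lt_or_gt_succ (v : Equiv.Perm ℕ) (i : ℕ) : v i < v (i + 1) ∨ v (i + 1) < v i :=
  lt_or_gt_of_ne fun h => by simpa using v.injective h

theorem finite_invSet_mul_sGen {v : Equiv.Perm ℕ} (hv : (invSet v).Finite) (i : ℕ) :
    (invSet (v * sGen i)).Finite := by
  rcases lt_or_gt_succ v i with h | h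
  · exact finite_invSet_mul_sGen_of_lt hv h
  · have he := invSet_mul_sGen (mul_sGen_lt_of_gt h)
    rw [mul_sGen_mul_sGen] at he
    rw [he] at hv
    exact (hv.subset (Set.subset_insert _ _)).of_finite_image (Equiv.injective _).injOn

theorem clen_mul_sGen_of_gt {v : Equiv.Perm ℕ} {i : ℕ} (hv : (invSet v).Finite)
    (h : v (i + 1) < v i) : clen v = clen (v * sGen i) + 1 := by
  simpa only [mul_sGen_mul_sGen] using
    clen_mul_sGen_of_lt (finite_invSet_mul_sGen hv i) (mul_sGen_lt_of_gt h)

theorem demStep_of_lt {v : Equiv.Perm ℕ} {i : ℕ} (hv : (invSet v).Finite)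
    (h : v i < v (i + 1)) : demStep v i = v * sGen i := by
  rw [demStep, if_pos (by rw [clen_mul_sGen_of_lt hv h]; exact Nat.lt_succ_self _)]

theorem demStep_of_gt {v : Equiv.Perm ℕ} {i : ℕ} (hv : (invSet v).Finite)
    (h : v (i + 1) < v i) : demStep v i = v := by
  rw [demStep, if_neg (by rw [clen_mul_sGen_of_gt hv h]; omega)]

/-! ### Reduced words -/

/-- The ordinary product of a word in the simple reflections. -/
def wordProd (L : List ℕ) : Equiv.Perm ℕ := (L.map sGen).prod

theorem wordProd_append_singleton (L : List ℕ) (i : ℕ) :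
    wordProd (L ++ [i]) = wordProd L * sGen i := by
  simp [wordProd]

theorem wordProd_cons (i : ℕ) (L : List ℕ) : wordProd (i :: L) = sGen i * wordProd L := by
  simp [wordProd]

theorem invSet_one : invSet 1 = ∅ := by
  ext ⟨p, q⟩
  simp only [invSet, Set.mem_ofPred_eq, Equiv.Perm.one_apply, Set.mem_empty_iff_false, iff_false]
  omega

theorem clen_one : clen 1 = 0 := by
  change (invSet 1).ncard = 0
  rw [invSet_one, Set.ncard_empty]

theorem finite_invSet_wordProd (L : List ℕ) : (invSet (wordProd L)).Finite := by
  induction L using List.reverseRecOn with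
  | nil => simp [wordProd, invSet_one]
  | append_singleton L i ih =>
    rw [wordProd_append_singleton]
    exact finite_invSet_mul_sGen ih i

theorem clen_wordProd_le (L : List ℕ) : clen (wordProd L) ≤ L.length := by
  induction L using List.reverseRecOn with
  | nil => simp [wordProd, clen_one]
  | append_singleton L i ih =>
    rw [wordProd_append_singleton, List.length_append, List.length_singleton]
    rcases lt_or_gt_succ (wordProd L) i with h | h
    · rw [clen_mul_sGen_of_lt (finite_invSet_wordProd L) h]
      omega
    · have := clen_mul_sGen_of_gt (finite_invSet_wordProd L) h
      omega

/-- A word is reduced if its length is the Coxeter length of its product. -/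
def IsReducedWord (L : List ℕ) : Prop := clen (wordProd L) = L.length

theorem IsReducedWord.append_singleton {L : List ℕ} {i : ℕ} (hL : IsReducedWord L)
    (h : wordProd L i < wordProd L (i + 1)) : IsReducedWord (L ++ [i]) := by
  rw [IsReducedWord, wordProd_append_singleton,
    clen_mul_sGen_of_lt (finite_invSet_wordProd L) h, hL, List.length_append,
    List.length_singleton]

theorem demWord_eq_wordProd {L : List ℕ} (hL : IsReducedWord L) : demWord L = wordProd L := by
  induction L using List.reverseRecOn with
  | nil => simp [demWord, wordProd]
  | append_singleton L i ih =>
    have hle := clen_wordProd_le L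
    rw [IsReducedWord, wordProd_append_singleton, List.length_append,
      List.length_singleton] at hL
    rcases lt_or_gt_succ (wordProd L) i with h | h
    · rw [clen_mul_sGen_of_lt (finite_invSet_wordProd L) h] at hL
      have hi := ih (Nat.succ_injective hL)
      rw [demWord] at hi ⊢
      rw [List.foldl_append, hi, List.foldl_cons, List.foldl_nil,
        demStep_of_lt (finite_invSet_wordProd L) h, wordProd_append_singleton]
    · have := clen_mul_sGen_of_gt (finite_invSet_wordProd L) h
      omega

theorem sGen_mul_eq_mul_sGen {u : Equiv.Perm ℕ} {c i : ℕ} (h : u i < u (i + 1))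
    (h' : (sGen c * u) (i + 1) < (sGen c * u) i) : sGen c * u = u * sGen i := by
  have hc : u i = c ∧ u (i + 1) = c + 1 := by
    simp only [Equiv.Perm.mul_apply, sGen_apply] at h'
    split_ifs at h' <;> omega
  rw [sGen, sGen, Equiv.mul_swap_eq_swap_mul, hc.1, hc.2]

/-- The exchange condition: a right descent of a word's product can be cancelled by
deleting one letter. -/
theorem exists_sublist_wordProd_mul_sGen (L : List ℕ) (i : ℕ)
    (h : wordProd L (i + 1) < wordProd L i) :
    ∃ L', L'.Sublist L ∧ L'.length + 1 = L.length ∧ wordProd L' = wordProd L * sGen i := by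
  induction L with
  | nil => simp [wordProd] at h
  | cons c T ih =>
    rcases lt_or_gt_succ (wordProd T) i with hT | hT
    · rw [wordProd_cons] at h
      refine ⟨T, List.sublist_cons_self c T, rfl, ?_⟩
      rw [wordProd_cons, sGen_mul_eq_mul_sGen hT h, mul_sGen_mul_sGen]
    · obtain ⟨T', hs, hl, hp⟩ := ih hT
      refine ⟨c :: T', hs.cons_cons c, by simp [hl], ?_⟩
      rw [wordProd_cons, wordProd_cons, hp, mul_assoc]

/-- Greedily extending a reduced word by a subword of `B` realizes the Demazure product. -/
theorem IsReducedWord.exists_sublist_append {A : List ℕ} (hA : IsReducedWord A) (B : List ℕ) :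
    ∃ B', B'.Sublist B ∧ IsReducedWord (A ++ B') ∧
      wordProd (A ++ B') = B.foldl demStep (wordProd A) := by
  induction B generalizing A with
  | nil => exact ⟨[], List.Sublist.refl _, by simpa using hA, by simp⟩
  | cons i B ih =>
    rcases lt_or_gt_succ (wordProd A) i with h | h
    · obtain ⟨B', hs, hr, hp⟩ := ih (hA.append_singleton h)
      refine ⟨i :: B', hs.cons_cons i, by simpa using hr, ?_⟩
      rw [List.foldl_cons, demStep_of_lt (finite_invSet_wordProd A) h,
        ← wordProd_append_singleton, ← hp, List.append_assoc, List.singleton_append]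
    · obtain ⟨B', hs, hr, hp⟩ := ih hA
      refine ⟨B', hs.cons i, hr, ?_⟩
      rw [List.foldl_cons, demStep_of_gt (finite_invSet_wordProd A) h, hp]

/-- Every letter of a word lies in a reduced subword with the same Demazure product. -/
theorem exists_reduced_subword_through (A B : List ℕ) (i : ℕ) :
    ∃ A' B', A'.Sublist A ∧ B'.Sublist B ∧ IsReducedWord (A' ++ i :: B') ∧
      wordProd (A' ++ i :: B') = demWord (A ++ i :: B) := by
  have hnil : IsReducedWord [] := by simp [IsReducedWord, wordProd, clen_one]
  obtain ⟨A₁, hA₁, hr, hp⟩ := hnil.exists_sublist_append A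
  rw [List.nil_append] at hr hp
  have key : ∃ A', A'.Sublist A ∧ IsReducedWord (A' ++ [i]) ∧
      wordProd (A' ++ [i]) = demStep (wordProd A₁) i := by
    rcases lt_or_gt_succ (wordProd A₁) i with h | h
    · exact ⟨A₁, hA₁, hr.append_singleton h, by
        rw [wordProd_append_singleton, demStep_of_lt (finite_invSet_wordProd _) h]⟩
    · obtain ⟨A₂, hs, hl, hq⟩ := exists_sublist_wordProd_mul_sGen A₁ i h
      have he : wordProd (A₂ ++ [i]) = wordProd A₁ := by
        rw [wordProd_append_singleton, hq, mul_sGen_mul_sGen]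
      refine ⟨A₂, hs.trans hA₁, ?_, ?_⟩
      · rw [IsReducedWord, he, hr, ← hl, List.length_append, List.length_singleton]
      · rw [he, demStep_of_gt (finite_invSet_wordProd _) h]
  obtain ⟨A', hA', hr', hp'⟩ := key
  obtain ⟨B', hB', hrB, hpB⟩ := hr'.exists_sublist_append B
  refine ⟨A', B', hA', hB', by simpa using hrB, ?_⟩
  rw [List.append_assoc, List.singleton_append] at hpB
  rw [hpB, hp', hp, demWord, List.foldl_append, List.foldl_cons]
  simp [wordProd]

/-! ### Reading lists of pipe dreams -/

/-- All positions of the `k × l` grid in reading order. -/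
def gridList (k l : ℕ) : List (ℕ × ℕ) :=
  (List.range k).flatMap fun i => ((List.range l).reverse).map fun j => (i, j)

theorem nodup_gridList (k l : ℕ) : (gridList k l).Nodup := by
  rw [gridList, List.nodup_flatMap]
  refine ⟨fun i _ => ?_, ?_⟩
  · exact (List.nodup_reverse.mpr List.nodup_range).map (Prod.mk_right_injective i)
  · refine List.nodup_range.imp ?_
    intro a b hab x hx hy
    simp only [List.mem_map] at hx hy
    obtain ⟨j, -, rfl⟩ := hx
    obtain ⟨j', -, he⟩ := hy
    exact hab (Prod.mk.inj he).1.symm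

theorem posList_eq_filter (k l : ℕ) (P : PD) :
    posList k l P = (gridList k l).filter fun pq => pq ∈ P := by
  rw [posList, gridList, List.filter_flatMap]
  congr 1
  funext i
  rw [List.filter_map, ← List.filterMap_eq_filter, List.map_filterMap]
  congr 1
  funext j
  by_cases h : (i, j) ∈ P <;> simp [Option.guard, h]

theorem mem_posList {k l : ℕ} {P : PD} {pq : ℕ × ℕ} :
    pq ∈ posList k l P ↔ (pq.1 < k ∧ pq.2 < l) ∧ pq ∈ P := by
  rw [posList_eq_filter]
  obtain ⟨p, q⟩ := pq
  simp [gridList]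

theorem List.Sublist.filter_mem_eq {α : Type*} {L M : List α} (h : L.Sublist M)
    (hM : M.Nodup) : M.filter (fun x => x ∈ L) = L := by
  have h₁ : L.Sublist (M.filter fun x => x ∈ L) := by
    have := h.filter (fun x => decide (x ∈ L))
    rwa [List.filter_eq_self.mpr (by simp)] at this
  refine (h₁.eq_of_length_le ?_).symm
  refine ((hM.filter _).subperm ?_).length_le
  intro x hx
  simpa using (List.mem_filter.mp hx).2

theorem posList_toFinset {k l : ℕ} {P : PD} {L : List (ℕ × ℕ)}
    (h : L.Sublist (posList k l P)) : posList k l L.toFinset = L := by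
  have hg : L.Sublist (gridList k l) := by
    rw [posList_eq_filter] at h
    exact h.trans List.filter_sublist
  rw [posList_eq_filter]
  convert hg.filter_mem_eq (nodup_gridList k l) using 2
  funext x
  exact decide_eq_decide.mpr List.mem_toFinset

/-- **Lemma 1 (crossing tiles lie in the union of the reduced pipe dreams).**
Let `w` be a `k × l` partial permutation (with minimal-length completion `w̃`) and
let `P` be a pipe dream in the `k × l` grid with Demazure product `δ(P) = w̃`, i.e.
`P ∈ 𝒫(w)`.  Then for every crossing tile `(i,j) ∈ P` there is a *reduced* pipe dream
`D ∈ RP(w)` (a `k × l` pipe dream with `δ(D) = w̃` and exactly `l(w̃)` crossing tiles)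
containing `(i,j)`. -/
theorem stmt0 (k l : ℕ) (w : ℕ → ℕ → Prop) (hw : IsPartialPerm k l w)
    (wt : Equiv.Perm ℕ) (hwt : IsMinCompletion k l w wt)
    (P : PD) (hP : InGrid k l P) (hPd : pdDelta k l P = wt) :
    ∀ pq ∈ P, ∃ D : PD, InGrid k l D ∧ pdDelta k l D = wt ∧ D.card = clen wt ∧ pq ∈ D := by
  rintro pq hpq
  obtain ⟨A, B, hAB⟩ := List.append_of_mem (mem_posList.mpr ⟨hP pq hpq, hpq⟩)
  have hsplit : pdWord k l P =
      A.map (fun pq => pq.1 + pq.2) ++ (pq.1 + pq.2) :: B.map (fun pq => pq.1 + pq.2) := by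
    rw [pdWord, hAB, List.map_append, List.map_cons]
  obtain ⟨A₁, B₁, hA₁, hB₁, hr, hp⟩ := exists_reduced_subword_through
    (A.map fun pq => pq.1 + pq.2) (B.map fun pq => pq.1 + pq.2) (pq.1 + pq.2)
  obtain ⟨A', hA', rfl⟩ := List.sublist_map_iff.mp hA₁
  obtain ⟨B', hB', rfl⟩ := List.sublist_map_iff.mp hB₁
  have hsub : (A' ++ pq :: B').Sublist (posList k l P) := by
    rw [hAB]
    exact List.Sublist.append hA' (List.Sublist.cons_cons pq hB')
  have hpos := posList_toFinset hsub
  have hnodup : (A' ++ pq :: B').Nodup := by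
    rw [posList_eq_filter] at hsub
    exact hsub.nodup ((nodup_gridList k l).filter _)
  have hword : pdWord k l (A' ++ pq :: B').toFinset =
      A'.map (fun pq => pq.1 + pq.2) ++ (pq.1 + pq.2) :: B'.map (fun pq => pq.1 + pq.2) := by
    rw [pdWord, hpos, List.map_append, List.map_cons]
  rw [← hsplit, ← pdDelta, hPd] at hp
  refine ⟨(A' ++ pq :: B').toFinset, ?_, ?_, ?_, ?_⟩
  · intro x hx
    exact (mem_posList.mp (hsub.subset (List.mem_toFinset.mp hx))).1
  · rw [pdDelta, hword, demWord_eq_wordProd hr, hp]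
  · rw [List.toFinset_card_of_nodup hnodup, ← hp, hr]
    simp
  · simp

end
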